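/- arXiv:2201.03490 — 7 statements merged into one kernel-verified Lean document; each statement's English description precedes it below -/
import Mathlib

section
/- Let P be a subset of the plane ℝ² with the triangle-filling property, let p ∈ P, and let r, s be points such that the closed segment [r,s] is contained in P. Then the set {x ∈ [r,s] : [p,x] ⊆ P} (i.e., the intersection of the visibility region V(p) of p with the segment [r,s]) is convex; in particular, if nonempty it is a single (possibly degenerate) line segment. -/
/-- If `P ⊆ ℝ²` has the triangle-filling property, `p ∈ P`, and the
segment `[r,s]` is contained in `P`, then the intersection of the visibility
region `V(p)` with `[r,s]`, i.e. `{x ∈ [r,s] : [p,x] ⊆ P}`, is convex. -/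
theorem visibility_region_inter_segment_convex
    (P : Set (ℝ × ℝ))
    (hfill : ∀ a b c : ℝ × ℝ, segment ℝ a b ⊆ P → segment ℝ b c ⊆ P →
      segment ℝ a c ⊆ P → convexHull ℝ {a, b, c} ⊆ P)
    (p : ℝ × ℝ) (hp : p ∈ P)
    (r s : ℝ × ℝ) (hrs : segment ℝ r s ⊆ P) :
    Convex ℝ {x | x ∈ segment ℝ r s ∧ segment ℝ p x ⊆ P} := by
  rw [convex_iff_segment_subset]
  rintro x ⟨hx, hpx⟩ y ⟨hy, hpy⟩ z hz
  have hxy : segment ℝ x y ⊆ segment ℝ r s := (convex_segment r s).segment_subset hx hy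
  have hull : convexHull ℝ {p, x, y} ⊆ P := hfill p x y hpx (hxy.trans hrs) hpy
  have hz' : z ∈ convexHull ℝ {p, x, y} :=
    segment_subset_convexHull (by simp) (by simp) hz
  exact ⟨hxy hz, ((convex_convexHull ℝ _).segment_subset
    (subset_convexHull ℝ _ (by simp)) hz').trans hull⟩
end

section
/- Let P_L be a subset of the plane ℝ² with the triangle-filling property, let D = [u,v] be a closed segment contained in P_L (a diagonal of the polygon), and let p ∈ P_L. Then the set {x ∈ D : [p,x] ⊆ P_L} — the intersection of the visibility cone V(p, D, P_L) of p through D with the diagonal D — is convex; in particular, it is a single line segment or empty. -/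
/-- If `P_L ⊆ ℝ²` has the triangle-filling property, the diagonal
`D = [u,v]` is contained in `P_L`, and `p ∈ P_L`, then the intersection of the
visibility cone `V(p, D, P_L)` with the diagonal `D`, which equals
`{x ∈ D : [p,x] ⊆ P_L}`, is convex (a single segment or empty). -/
theorem visibility_cone_inter_diagonal_convex
    (PL : Set (ℝ × ℝ))
    (hfill : ∀ a b c : ℝ × ℝ, segment ℝ a b ⊆ PL → segment ℝ b c ⊆ PL →
      segment ℝ a c ⊆ PL → convexHull ℝ {a, b, c} ⊆ PL)
    (u v : ℝ × ℝ) (hD : segment ℝ u v ⊆ PL)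
    (p : ℝ × ℝ) (hp : p ∈ PL) :
    Convex ℝ {x | x ∈ segment ℝ u v ∧ segment ℝ p x ⊆ PL} := by
  rw [convex_iff_segment_subset]
  rintro x ⟨hx, hpx⟩ y ⟨hy, hpy⟩ z hz
  have hxy : segment ℝ x y ⊆ segment ℝ u v := (convex_segment u v).segment_subset hx hy
  have hull_subset := hfill p x y hpx (hxy.trans hD) hpy
  have mem_hull : ∀ w ∈ ({p, x, y} : Set (ℝ × ℝ)), w ∈ convexHull ℝ {p, x, y} :=
    fun w hw => subset_convexHull ℝ _ hw
  have hull_convex := convex_convexHull ℝ ({p, x, y} : Set (ℝ × ℝ))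
  have hz_hull := hull_convex.segment_subset (mem_hull x (by simp)) (mem_hull y (by simp)) hz
  exact ⟨hxy hz, (hull_convex.segment_subset (mem_hull p (by simp)) hz_hull).trans hull_subset⟩
end

section
/- Let P_L and P_R be closed subsets of ℝ² whose intersection P_L ∩ P_R equals a closed segment D = [u,v] (the diagonal), and set P = P_L ∪ P_R. Let p ∈ P_L \ D and q ∈ P_R \ D. Then p and q see each other in P (i.e., the segment [p,q] is contained in P) if and only if both of the following hold: (i) there exists r ∈ D with r ∈ [p,q] and [p,r] ⊆ P_L (i.e., q lies in the visibility cone V(p, D, P_L) of p through D), and (ii) there exists r' ∈ D with r' ∈ [p,q] and [r',q] ⊆ P_R (i.e., p lies in the visibility cone V(q, D, P_R) of q through D). -/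
theorem lineMap_mem_segment_lineMap {E : Type*} [AddCommGroup E] [Module ℝ E] (p q : E)
    {a b t : ℝ} (hat : a ≤ t) (htb : t ≤ b) :
    AffineMap.lineMap p q t ∈
      segment ℝ (AffineMap.lineMap p q a : E) (AffineMap.lineMap p q b) := by
  rw [← image_segment, segment_eq_Icc (hat.trans htb)]
  exact ⟨t, ⟨hat, htb⟩, rfl⟩

/-- If two closed sets cover a segment from a point of the first to a point of the second, then
some point of the segment lies in both sets and is seen from the first endpoint inside the
first set. -/
theorem exists_mem_inter_segment_subset {E : Type*} [AddCommGroup E] [Module ℝ E]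
    [TopologicalSpace E] [IsTopologicalAddGroup E] [ContinuousSMul ℝ E]
    {A B : Set E} (hA : IsClosed A) (hB : IsClosed B) {p q : E} (hp : p ∈ A) (hq : q ∈ B)
    (h : segment ℝ p q ⊆ A ∪ B) :
    ∃ r ∈ A ∩ B, r ∈ segment ℝ p q ∧ segment ℝ p r ⊆ A := by
  set f : ℝ →ᵃ[ℝ] E := AffineMap.lineMap p q with hf
  have hf0 : f 0 = p := AffineMap.lineMap_apply_zero p q
  have hf1 : f 1 = q := AffineMap.lineMap_apply_one p q
  have hfc : Continuous f := AffineMap.lineMap_continuous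
  have hseg : ∀ t, 0 ≤ t → t ≤ 1 → f t ∈ segment ℝ p q := fun t h0 h1 => by
    simpa [hf] using lineMap_mem_segment_lineMap p q h0 h1
  obtain ⟨s, ⟨⟨hs0, hs1⟩, hsB⟩, hmin⟩ :=
    (isCompact_Icc.inter_right (hB.preimage hfc)).exists_isLeast
      ⟨1, ⟨zero_le_one, le_rfl⟩, Set.mem_preimage.2 (hf1.symm ▸ hq)⟩
  have hIco : Set.Ico 0 s ⊆ f ⁻¹' A := fun t ht =>
    (h (hseg t ht.1 (ht.2.le.trans hs1))).resolve_right fun htB =>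
      ht.2.not_ge (hmin ⟨⟨ht.1, ht.2.le.trans hs1⟩, htB⟩)
  have hIcc : Set.Icc 0 s ⊆ f ⁻¹' A := by
    rcases hs0.eq_or_lt with rfl | hpos
    · simpa [hf0] using hp
    · rw [← closure_Ico hpos.ne]
      exact closure_minimal hIco (hA.preimage hfc)
  refine ⟨f s, ⟨hIcc ⟨hs0, le_rfl⟩, hsB⟩, hseg s hs0 hs1, ?_⟩
  rw [← hf0, ← image_segment, segment_eq_Icc hs0]
  exact Set.image_subset_iff.2 hIcc


/-- Let `P_L, P_R` be closed subsets of `ℝ²` with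
`P_L ∩ P_R = D = [u,v]` and `P = P_L ∪ P_R`. For `p ∈ P_L \ D` and
`q ∈ P_R \ D`, the points `p` and `q` see each other in `P` iff
`q ∈ V(p, D, P_L)` and `p ∈ V(q, D, P_R)`, expressed via points of `D`
on the segment `[p,q]`. -/
theorem mutual_visibility_iff_cones
    (PL PR : Set (ℝ × ℝ)) (hLc : IsClosed PL) (hRc : IsClosed PR)
    (u v : ℝ × ℝ) (hD : PL ∩ PR = segment ℝ u v)
    (p q : ℝ × ℝ)
    (hp : p ∈ PL \ segment ℝ u v) (hq : q ∈ PR \ segment ℝ u v) :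
    segment ℝ p q ⊆ PL ∪ PR ↔
      ((∃ r ∈ segment ℝ u v, r ∈ segment ℝ p q ∧ segment ℝ p r ⊆ PL) ∧
       (∃ r' ∈ segment ℝ u v, r' ∈ segment ℝ p q ∧ segment ℝ r' q ⊆ PR)) := by
  constructor
  · intro h
    constructor
    · obtain ⟨r, hr, hrs, hpr⟩ := exists_mem_inter_segment_subset hLc hRc hp.1 hq.1 h
      exact ⟨r, hD ▸ hr, hrs, hpr⟩
    · rw [segment_symm, Set.union_comm] at h
      obtain ⟨r, hr, hrs, hqr⟩ := exists_mem_inter_segment_subset hRc hLc hq.1 hp.1 h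
      rw [Set.inter_comm] at hr
      rw [segment_symm] at hrs hqr
      exact ⟨r, hD ▸ hr, hrs, hqr⟩
  · rintro ⟨⟨r, hrD, hr, hpr⟩, r', hrD', hr', hrq⟩ x hx
    rw [segment_eq_image_lineMap] at hr hr' hx
    obtain ⟨s, -, rfl⟩ := hr
    obtain ⟨s', -, rfl⟩ := hr'
    obtain ⟨t, ⟨ht0, ht1⟩, rfl⟩ := hx
    rcases le_total t s with hts | hst
    · left
      apply hpr
      simpa using lineMap_mem_segment_lineMap p q ht0 hts
    rcases le_total s' t with hst' | hts'
    · right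
      apply hrq
      simpa using lineMap_mem_segment_lineMap p q hst' ht1
    · left
      have hmem := (convex_segment u v).segment_subset hrD hrD'
        (lineMap_mem_segment_lineMap p q hst hts')
      rw [← hD] at hmem
      exact hmem.1
end

section
/- Let P_L and P_R be closed subsets of ℝ² whose intersection P_L ∩ P_R equals a closed segment D = [u,v]. Let p ∈ P_L \ D and q ∈ P_R \ D, and suppose the segment [p,q] is contained in P_L ∪ P_R. Then [p,q] crosses the diagonal D: there exists a point r ∈ D ∩ [p,q] such that [p,r] ⊆ P_L and [r,q] ⊆ P_R. -/
/-- If `A` and `B` are closed with convex intersection and cover the segment from `p ∈ A` to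
`r ∈ A ∩ B`, then the whole segment lies in `A`. -/
theorem segment_subset_left_of_subset_union {E : Type*} [AddCommGroup E] [Module ℝ E]
    [TopologicalSpace E] [ContinuousAdd E] [ContinuousSMul ℝ E] {A B : Set E}
    (hA : IsClosed A) (hB : IsClosed B) (hAB : Convex ℝ (A ∩ B)) {p r : E}
    (hp : p ∈ A) (hr : r ∈ A ∩ B) (h : segment ℝ p r ⊆ A ∪ B) :
    segment ℝ p r ⊆ A := by
  intro x hx
  rcases h hx with hxA | hxB
  · exact hxA
  have hsub : segment ℝ p x ⊆ A ∪ B :=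
    ((convex_segment p r).segment_subset (left_mem_segment ℝ p r) hx).trans h
  obtain ⟨y, hy, hyAB⟩ := isPreconnected_closed_iff.1 (convex_segment p x).isPreconnected
    A B hA hB hsub ⟨p, left_mem_segment ℝ p x, hp⟩ ⟨x, right_mem_segment ℝ p x, hxB⟩
  rw [mem_segment_iff_wbtw] at hx hy
  exact (hAB.segment_subset hyAB hr (mem_segment_iff_wbtw.2 (hx.trans_left_right hy))).1

/-- Let `P_L, P_R` be closed subsets of `ℝ²` with
`P_L ∩ P_R = D = [u,v]`. If `p ∈ P_L \ D`, `q ∈ P_R \ D`, and the segment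
`[p,q]` is contained in `P_L ∪ P_R`, then `[p,q]` crosses the diagonal: there
is `r ∈ D ∩ [p,q]` with `[p,r] ⊆ P_L` and `[r,q] ⊆ P_R`. -/
theorem segment_crosses_diagonal
    (PL PR : Set (ℝ × ℝ)) (hLc : IsClosed PL) (hRc : IsClosed PR)
    (u v : ℝ × ℝ) (hD : PL ∩ PR = segment ℝ u v)
    (p q : ℝ × ℝ)
    (hp : p ∈ PL \ segment ℝ u v) (hq : q ∈ PR \ segment ℝ u v)
    (hpq : segment ℝ p q ⊆ PL ∪ PR) :
    ∃ r, r ∈ segment ℝ u v ∧ r ∈ segment ℝ p q ∧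
      segment ℝ p r ⊆ PL ∧ segment ℝ r q ⊆ PR := by
  have hconv : Convex ℝ (PL ∩ PR) := hD ▸ convex_segment u v
  obtain ⟨r, hr, hrD⟩ := isPreconnected_closed_iff.1 (convex_segment p q).isPreconnected
    PL PR hLc hRc hpq ⟨p, left_mem_segment ℝ p q, hp.1⟩ ⟨q, right_mem_segment ℝ p q, hq.1⟩
  refine ⟨r, hD ▸ hrD, hr, ?_, ?_⟩
  · exact segment_subset_left_of_subset_union hLc hRc hconv hp.1 hrD
      (((convex_segment p q).segment_subset (left_mem_segment ℝ p q) hr).trans hpq)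
  · rw [segment_symm]
    rw [Set.inter_comm] at hconv hrD
    rw [Set.union_comm] at hpq
    exact segment_subset_left_of_subset_union hRc hLc hconv hq.1 hrD
      (((convex_segment p q).segment_subset (right_mem_segment ℝ p q) hr).trans hpq)
end

section
/- Work in the plane ℝ × ℝ. Let ℓ ∈ ℝ and let C be a cone with apex a = (a₁, a₂) where a₁ < ℓ, opening rightward between two boundary rays of slopes s_L ≤ s_U, i.e., C = {z : z.1 ≥ a₁ and s_L·(z.1 − a₁) ≤ z.2 − a₂ ≤ s_U·(z.1 − a₁)} (so both boundary rays of C cross the vertical line x = ℓ). Let p and q be points with p.1 > ℓ and q.1 > ℓ. Then the segment [p,q] is disjoint from C if and only if either both p and q lie strictly above the supporting line of the upper boundary of C (i.e., z.2 − a₂ > s_U·(z.1 − a₁) for z ∈ {p,q}), or both p and q lie strictly below the supporting line of the lower boundary of C (i.e., z.2 − a₂ < s_L·(z.1 − a₁) for z ∈ {p,q}). -/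
/-- A segment joining a point strictly above the line through `a` of slope `s` to a point strictly
below it meets that line. -/
theorem exists_mem_segment_on_line {a p q : ℝ × ℝ} {s : ℝ}
    (hp : s * (p.1 - a.1) < p.2 - a.2) (hq : q.2 - a.2 < s * (q.1 - a.1)) :
    ∃ z ∈ segment ℝ p q, z.2 - a.2 = s * (z.1 - a.1) := by
  set u := p.2 - a.2 - s * (p.1 - a.1) with hu
  set v := s * (q.1 - a.1) - (q.2 - a.2) with hv
  have hu0 : 0 < u := by linarith
  have hv0 : 0 < v := by linarith
  have huv : u + v ≠ 0 := by positivity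
  refine ⟨(v / (u + v)) • p + (u / (u + v)) • q,
    ⟨v / (u + v), u / (u + v), by positivity, by positivity, by field_simp; ring, rfl⟩, ?_⟩
  simp only [Prod.fst_add, Prod.snd_add, Prod.smul_fst, Prod.smul_snd, smul_eq_mul]
  field_simp
  rw [hu, hv]
  ring

/-- The first coordinate of a point of a segment is bounded below by any common strict lower bound
of the first coordinates of the endpoints. -/
theorem lt_fst_of_mem_segment {p q z : ℝ × ℝ} {c : ℝ} (hp : c < p.1) (hq : c < q.1)
    (hz : z ∈ segment ℝ p q) : c < z.1 :=
  (convex_halfSpace_gt (f := (Prod.fst : ℝ × ℝ → ℝ))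
    ⟨fun _ _ => rfl, fun _ _ => rfl⟩ c).segment_subset
    hp hq hz

/-- The open half-plane above the line through `a` of slope `s` is convex. -/
theorem convex_above_line (a : ℝ × ℝ) (s : ℝ) :
    Convex ℝ {z : ℝ × ℝ | s * (z.1 - a.1) < z.2 - a.2} := by
  have h : IsLinearMap ℝ (fun z : ℝ × ℝ => z.2 - s * z.1) :=
    ⟨fun x y => by simp only [Prod.fst_add, Prod.snd_add]; ring,
      fun c x => by simp only [Prod.smul_fst, Prod.smul_snd, smul_eq_mul]; ring⟩
  have hset : {z : ℝ × ℝ | s * (z.1 - a.1) < z.2 - a.2} = {z | a.2 - s * a.1 < z.2 - s * z.1} := by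
    ext z
    simp only [Set.mem_ofPred_eq]
    constructor <;> intro hz <;> linarith
  exact hset ▸ convex_halfSpace_gt h (a.2 - s * a.1)

/-- The open half-plane below the line through `a` of slope `s` is convex. -/
theorem convex_below_line (a : ℝ × ℝ) (s : ℝ) :
    Convex ℝ {z : ℝ × ℝ | z.2 - a.2 < s * (z.1 - a.1)} := by
  have h : IsLinearMap ℝ (fun z : ℝ × ℝ => z.2 - s * z.1) :=
    ⟨fun x y => by simp only [Prod.fst_add, Prod.snd_add]; ring,
      fun c x => by simp only [Prod.smul_fst, Prod.smul_snd, smul_eq_mul]; ring⟩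
  have hset : {z : ℝ × ℝ | z.2 - a.2 < s * (z.1 - a.1)} = {z | z.2 - s * z.1 < a.2 - s * a.1} := by
    ext z
    simp only [Set.mem_ofPred_eq]
    constructor <;> intro hz <;> linarith
  exact hset ▸ convex_halfSpace_lt h (a.2 - s * a.1)

/-- Let `C` be a cone with apex `a`, `a.1 < ℓ`, opening rightward
between boundary rays of slopes `s_L ≤ s_U`. For points `p, q` strictly right
of the vertical line `x = ℓ`, the segment `[p,q]` is disjoint from `C` iff
both `p` and `q` lie strictly above the supporting line of the upper boundary,
or both lie strictly below the supporting line of the lower boundary. -/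
theorem segment_disjoint_cone_iff
    (ℓ : ℝ) (a : ℝ × ℝ) (ha : a.1 < ℓ)
    (sL sU : ℝ) (hs : sL ≤ sU)
    (C : Set (ℝ × ℝ))
    (hC : C = {z : ℝ × ℝ | a.1 ≤ z.1 ∧
      sL * (z.1 - a.1) ≤ z.2 - a.2 ∧ z.2 - a.2 ≤ sU * (z.1 - a.1)})
    (p q : ℝ × ℝ) (hp : ℓ < p.1) (hq : ℓ < q.1) :
    segment ℝ p q ∩ C = ∅ ↔
      ((sU * (p.1 - a.1) < p.2 - a.2 ∧ sU * (q.1 - a.1) < q.2 - a.2) ∨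
       (p.2 - a.2 < sL * (p.1 - a.1) ∧ q.2 - a.2 < sL * (q.1 - a.1))) := by
  subst hC
  have hpa : a.1 < p.1 := ha.trans hp
  have hqa : a.1 < q.1 := ha.trans hq
  rw [Set.eq_empty_iff_forall_notMem]
  constructor
  · intro h
    have above_or_below : ∀ z ∈ segment ℝ p q,
        sU * (z.1 - a.1) < z.2 - a.2 ∨ z.2 - a.2 < sL * (z.1 - a.1) := by
      intro z hz
      by_contra! hcon
      exact h z ⟨hz, (lt_fst_of_mem_segment hpa hqa hz).le, hcon.2, hcon.1⟩
    have avoid_upper : ∀ z ∈ segment ℝ p q, z.2 - a.2 ≠ sU * (z.1 - a.1) := by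
      intro z hz heq
      have hza := lt_fst_of_mem_segment hpa hqa hz
      have hslope := mul_le_mul_of_nonneg_right hs (sub_pos.2 hza).le
      exact h z ⟨hz, hza.le, hslope.trans heq.ge, heq.le⟩
    have hpU := mul_le_mul_of_nonneg_right hs (sub_pos.2 hpa).le
    have hqU := mul_le_mul_of_nonneg_right hs (sub_pos.2 hqa).le
    rcases above_or_below p (left_mem_segment ℝ p q) with h₁ | h₁ <;>
      rcases above_or_below q (right_mem_segment ℝ p q) with h₂ | h₂
    · exact Or.inl ⟨h₁, h₂⟩
    · obtain ⟨z, hz, heq⟩ := exists_mem_segment_on_line h₁ (h₂.trans_le hqU)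
      exact absurd heq (avoid_upper z hz)
    · obtain ⟨z, hz, heq⟩ := exists_mem_segment_on_line h₂ (h₁.trans_le hpU)
      exact absurd heq (avoid_upper z (segment_symm ℝ q p ▸ hz))
    · exact Or.inr ⟨h₁, h₂⟩
  · rintro (⟨h₁, h₂⟩ | ⟨h₁, h₂⟩) z ⟨hz, -, hzL, hzU⟩
    · exact hzU.not_gt ((convex_above_line a sU).segment_subset h₁ h₂ hz)
    · exact hzL.not_gt ((convex_below_line a sL).segment_subset h₁ h₂ hz)
end

section
/- Work in the plane ℝ × ℝ. Let d ∈ ℝ, and let D be the vertical segment from u = (d, u₂) to v = (d, v₂) with u₂ ≤ v₂. Let P_L and P_R be closed sets with P_L ⊆ {z : z.1 ≤ d}, P_R ⊆ {z : z.1 ≥ d}, P_L ∩ P_R = D, and P = P_L ∪ P_R. Let [a,c] be a segment contained in P_L with a.1 < d and c.1 < d. Let w = (d, w₂) and x = (d, x₂) with u₂ ≤ w₂ ≤ x₂ ≤ v₂, and let s_R ≤ s_L be real slopes such that every visibility-glass segment from [a,c] to D satisfies the extremal constraints: for all y ∈ [a,c] and z ∈ D with [y,z] ⊆ P_L, one has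 w₂ ≤ z.2 ≤ x₂ and s_R·(d − y.1) ≤ z.2 − y.2 ≤ s_L·(d − y.1). Then every point p ∈ P_R that sees some point of [a,c] in P (i.e., there is y ∈ [a,c] with [p,y] ⊆ P) lies in the visibility glass cone C: p.2 ≤ x₂ + s_L·(p.1 − d) and p.2 ≥ w₂ + s_R·(p.1 − d). -/
open AffineMap in
/-- A segment that joins a point strictly left of a vertical line to a point of a closed set `PR`
weakly right of it, inside `PL ∪ PR`, crosses the line in a point of `PL ∩ PR`, and its part left
of the line is contained in `PL`. -/
lemma exists_crossing_of_segment_subset_union {d : ℝ} {PL PR : Set (ℝ × ℝ)}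
    (hLc : IsClosed PL) (hRc : IsClosed PR)
    (hLsub : PL ⊆ {z : ℝ × ℝ | z.1 ≤ d}) (hRsub : PR ⊆ {z : ℝ × ℝ | d ≤ z.1})
    {y p : ℝ × ℝ} (hy : y.1 < d) (hp : p ∈ PR) (hyp : segment ℝ y p ⊆ PL ∪ PR) :
    ∃ t : ℝ, 0 < t ∧ t ≤ 1 ∧ y.1 + t * (p.1 - y.1) = d ∧
      lineMap y p t ∈ PL ∩ PR ∧ segment ℝ y (lineMap y p t) ⊆ PL := by
  have hpd : d ≤ p.1 := hRsub hp
  have hpos : 0 < p.1 - y.1 := by linarith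
  have hfst (r : ℝ) : (lineMap y p r : ℝ × ℝ).1 = y.1 + r * (p.1 - y.1) := by
    simp [lineMap_apply]; ring
  have hcont : Continuous (lineMap y p : ℝ → ℝ × ℝ) := lineMap_continuous
  have hunion {r : ℝ} (h0 : 0 ≤ r) (h1 : r ≤ 1) : lineMap y p r ∈ PL ∪ PR :=
    hyp (segment_eq_image_lineMap ℝ y p ▸ Set.mem_image_of_mem _ ⟨h0, h1⟩)
  obtain ⟨t, ht⟩ : ∃ t : ℝ, t * (p.1 - y.1) = d - y.1 :=
    ⟨(d - y.1) / (p.1 - y.1), div_mul_cancel₀ _ hpos.ne'⟩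
  have ht0 : 0 < t := by
    by_contra! h
    nlinarith
  have ht1 : t ≤ 1 := by
    by_contra! h
    nlinarith
  have hleft : Set.Icc 0 t ⊆ lineMap y p ⁻¹' PL := by
    rw [← closure_Ico ht0.ne]
    refine closure_minimal (fun r hr ↦ ?_) (hLc.preimage hcont)
    refine (hunion hr.1 (hr.2.le.trans ht1)).resolve_right fun h ↦ ?_
    have h' : d ≤ _ := hRsub h
    rw [hfst] at h'
    nlinarith [hr.2]
  have hright : lineMap y p t ∈ PR := by
    rcases ht1.eq_or_lt with rfl | ht1
    · simpa using hp
    · have hsub : Set.Icc t 1 ⊆ lineMap y p ⁻¹' PR := by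
        rw [← closure_Ioc ht1.ne]
        refine closure_minimal (fun r hr ↦ ?_) (hRc.preimage hcont)
        refine (hunion (ht0.trans hr.1).le hr.2).resolve_left fun h ↦ ?_
        have h' : _ ≤ d := hLsub h
        rw [hfst] at h'
        nlinarith [hr.1]
      exact hsub ⟨le_rfl, ht1.le⟩
  refine ⟨t, ht0, ht1, by linarith, ⟨hleft ⟨ht0.le, le_rfl⟩, hright⟩, ?_⟩
  rw [segment_eq_image_lineMap]
  rintro _ ⟨r, hr, rfl⟩
  rw [lineMap_lineMap_right]
  exact hleft ⟨mul_nonneg hr.1 ht0.le, mul_le_of_le_one_left ht0.le hr.2⟩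

/-- Visibility glass cone for a segment `[a,c]` left of a
vertical diagonal `D = [(d,u₂),(d,v₂)]` splitting `P = P_L ∪ P_R`. Every point
`p ∈ P_R` that sees some point of `[a,c]` in `P` lies in the visibility glass
cone determined by the subsegment `[w,x]` of `D` and extremal slopes
`s_R ≤ s_L`. -/
theorem mem_visibility_glass_cone_of_sees_segment
    (d u₂ v₂ : ℝ) (huv : u₂ ≤ v₂)
    (PL PR : Set (ℝ × ℝ)) (hLc : IsClosed PL) (hRc : IsClosed PR)
    (hLsub : PL ⊆ {z : ℝ × ℝ | z.1 ≤ d}) (hRsub : PR ⊆ {z : ℝ × ℝ | d ≤ z.1})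
    (hD : PL ∩ PR = segment ℝ (d, u₂) (d, v₂))
    (a c : ℝ × ℝ) (hac : segment ℝ a c ⊆ PL) (ha : a.1 < d) (hc : c.1 < d)
    (w₂ x₂ : ℝ) (huw : u₂ ≤ w₂) (hwx : w₂ ≤ x₂) (hxv : x₂ ≤ v₂)
    (sR sL : ℝ) (hs : sR ≤ sL)
    (hglass : ∀ y ∈ segment ℝ a c, ∀ z ∈ segment ℝ (d, u₂) (d, v₂),
      segment ℝ y z ⊆ PL →
        w₂ ≤ z.2 ∧ z.2 ≤ x₂ ∧
        sR * (d - y.1) ≤ z.2 - y.2 ∧ z.2 - y.2 ≤ sL * (d - y.1))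
    (p : ℝ × ℝ) (hpR : p ∈ PR)
    (hsee : ∃ y ∈ segment ℝ a c, segment ℝ p y ⊆ PL ∪ PR) :
    p.2 ≤ x₂ + sL * (p.1 - d) ∧ w₂ + sR * (p.1 - d) ≤ p.2 := by
  obtain ⟨y, hy, hseg⟩ := hsee
  have hyd : y.1 < d := ((convex_Iio d).is_linear_preimage
    (LinearMap.fst ℝ ℝ ℝ).isLinear).segment_subset ha hc hy
  obtain ⟨t, ht0, ht1, htd, hz, hyz⟩ := exists_crossing_of_segment_subset_union hLc hRc hLsub hRsub
    hyd hpR (segment_symm ℝ p y ▸ hseg)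
  obtain ⟨hw, hx, hR, hL⟩ := hglass y hy _ (hD ▸ hz) hyz
  have hsnd : (AffineMap.lineMap y p t : ℝ × ℝ).2 = y.2 + t * (p.2 - y.2) := by
    simp [AffineMap.lineMap_apply]; ring
  rw [hsnd] at hw hx hR hL
  have hdy : d - y.1 = t * (p.1 - y.1) := by linarith
  rw [hdy] at hR hL
  have hL' : p.2 - y.2 ≤ sL * (p.1 - y.1) := by
    refine le_of_mul_le_mul_left ?_ ht0
    linarith
  have hR' : sR * (p.1 - y.1) ≤ p.2 - y.2 := by
    refine le_of_mul_le_mul_left ?_ ht0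
    linarith
  have h1 := mul_le_mul_of_nonneg_left hL' (sub_nonneg.2 ht1)
  have h2 := mul_le_mul_of_nonneg_left hR' (sub_nonneg.2 ht1)
  rw [← htd]
  constructor <;> linarith
end

section
/- Work in the plane ℝ × ℝ. Let d ∈ ℝ, and let D be the vertical segment from u = (d, u₂) to v = (d, v₂) with u₂ ≤ v₂. Let P_L and P_R be closed sets with P_L ⊆ {z : z.1 ≤ d}, P_R ⊆ {z : z.1 ≥ d}, P_L ∩ P_R = D, and P = P_L ∪ P_R. Let S be a set (a simple polygon) contained in P_L with S ⊆ {z : z.1 < d}. Let w = (d, w₂) and x = (d, x₂) with u₂ ≤ w₂ ≤ x₂ ≤ v₂, and let s_R ≤ s_L be real slopes such that every visibility-glass segment from S to D satisfies the extremal constraints: for all y ∈ S and z ∈ D with [y,z] ⊆ P_L, one has w₂ ≤ z.2 ≤ x₂ and s_R·(d − y.1) ≤ z.2 − y.2 ≤ s_L·(d − y.1). Then every point p ∈ P_R that sees some point of S in P (i.e., there is y ∈ S with [p,y] ⊆ P) lies in the visibility glass cone C: p.2 ≤ x₂ + s_L·(p.1 − d) and p.2 ≥ w₂ + s_R·(p.1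 − d). -/
/-- A path that stays in `A ∪ B` on `[0, 1]`, strictly left of the vertical line `x = d` before
time `t₀` and strictly right of it afterwards, is in `A` up to time `t₀`, and crosses the line in
`A ∩ B`, when `A` and `B` are closed and lie on the two sides of the line. -/
theorem mem_left_and_crossing_mem_inter {d : ℝ} {A B : Set (ℝ × ℝ)}
    (hA : IsClosed A) (hB : IsClosed B)
    (hAd : A ⊆ {z : ℝ × ℝ | z.1 ≤ d}) (hBd : B ⊆ {z : ℝ × ℝ | d ≤ z.1})
    {f : ℝ → ℝ × ℝ} (hf : Continuous f) (hfAB : ∀ t ∈ Set.Icc (0 : ℝ) 1, f t ∈ A ∪ B)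
    {t₀ : ℝ} (h0 : 0 < t₀) (h1 : t₀ ≤ 1)
    (hlt : ∀ t < t₀, (f t).1 < d) (hgt : ∀ t, t₀ < t → d < (f t).1) (hend : f 1 ∈ B) :
    (∀ t ∈ Set.Icc 0 t₀, f t ∈ A) ∧ f t₀ ∈ A ∩ B := by
  have hleft : Set.Icc 0 t₀ ⊆ f ⁻¹' A := by
    rw [← closure_Ico h0.ne]
    refine closure_minimal (fun t ht => ?_) (hA.preimage hf)
    exact (hfAB t ⟨ht.1, ht.2.le.trans h1⟩).resolve_right
      fun h => (hlt t ht.2).not_ge (hBd h)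
  refine ⟨hleft, hleft ⟨h0.le, le_rfl⟩, ?_⟩
  rcases h1.eq_or_lt with rfl | h1
  · exact hend
  have hright : Set.Icc t₀ 1 ⊆ f ⁻¹' B := by
    rw [← closure_Ioc h1.ne]
    refine closure_minimal (fun t ht => ?_) (hB.preimage hf)
    exact (hfAB t ⟨h0.le.trans ht.1.le, ht.2⟩).resolve_left
      fun h => (hgt t ht.1).not_ge (hAd h)
  exact hright ⟨le_rfl, h1.le⟩


/-- Visibility glass cone for a region (simple polygon) `S` lying
strictly left of a vertical diagonal `D = [(d,u₂),(d,v₂)]` splitting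
`P = P_L ∪ P_R`. Every point `p ∈ P_R` that sees some point of `S` in `P`
lies in the visibility glass cone determined by the subsegment `[w,x]` of `D`
and extremal slopes `s_R ≤ s_L`. -/
theorem mem_visibility_glass_cone_of_sees_region
    (d u₂ v₂ : ℝ) (huv : u₂ ≤ v₂)
    (PL PR : Set (ℝ × ℝ)) (hLc : IsClosed PL) (hRc : IsClosed PR)
    (hLsub : PL ⊆ {z : ℝ × ℝ | z.1 ≤ d}) (hRsub : PR ⊆ {z : ℝ × ℝ | d ≤ z.1})
    (hD : PL ∩ PR = segment ℝ (d, u₂) (d, v₂))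
    (S : Set (ℝ × ℝ)) (hSL : S ⊆ PL) (hSd : S ⊆ {z : ℝ × ℝ | z.1 < d})
    (w₂ x₂ : ℝ) (huw : u₂ ≤ w₂) (hwx : w₂ ≤ x₂) (hxv : x₂ ≤ v₂)
    (sR sL : ℝ) (hs : sR ≤ sL)
    (hglass : ∀ y ∈ S, ∀ z ∈ segment ℝ (d, u₂) (d, v₂),
      segment ℝ y z ⊆ PL →
        w₂ ≤ z.2 ∧ z.2 ≤ x₂ ∧
        sR * (d - y.1) ≤ z.2 - y.2 ∧ z.2 - y.2 ≤ sL * (d - y.1))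
    (p : ℝ × ℝ) (hpR : p ∈ PR)
    (hsee : ∃ y ∈ S, segment ℝ p y ⊆ PL ∪ PR) :
    p.2 ≤ x₂ + sL * (p.1 - d) ∧ w₂ + sR * (p.1 - d) ≤ p.2 := by
  obtain ⟨y, hy, hyp⟩ := hsee
  have hyd : y.1 < d := hSd hy
  have hpd : d ≤ p.1 := hRsub hpR
  have hpy : 0 < p.1 - y.1 := by linarith
  set t₀ := (d - y.1) / (p.1 - y.1) with ht₀
  have h0 : 0 < t₀ := div_pos (by linarith) hpy
  have h1 : t₀ ≤ 1 := (div_le_one hpy).2 (by linarith)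
  have hmul : t₀ * (p.1 - y.1) = d - y.1 := div_mul_cancel₀ _ hpy.ne'
  let f : ℝ → ℝ × ℝ := fun t => y + t • (p - y)
  have hf1 (t : ℝ) : (f t).1 = y.1 + t * (p.1 - y.1) := by simp [f]
  have hf2 (t : ℝ) : (f t).2 = y.2 + t * (p.2 - y.2) := by simp [f]
  obtain ⟨hleft, hcross⟩ := mem_left_and_crossing_mem_inter hLc hRc hLsub hRsub
    (f := f) (by fun_prop)
    (fun t ht => hyp (by
      rw [segment_symm, segment_eq_image']
      exact ⟨t, ht, rfl⟩))
    h0 h1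
    (fun t ht => by
      rw [hf1]
      linarith [mul_lt_mul_of_pos_right ht hpy])
    (fun t ht => by
      rw [hf1]
      linarith [mul_lt_mul_of_pos_right ht hpy])
    (by simpa [f] using hpR)
  have hseg : segment ℝ y (f t₀) ⊆ PL := by
    rw [segment_eq_image']
    rintro _ ⟨r, hr, rfl⟩
    have hmem := hleft (r * t₀) ⟨mul_nonneg hr.1 h0.le, mul_le_of_le_one_left h0.le hr.2⟩
    simpa [f, mul_smul] using hmem
  rw [hD] at hcross
  obtain ⟨hw, hx, hR, hL⟩ := hglass y hy (f t₀) hcross hseg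
  rw [hf2] at hw hx hR hL
  have hslopeL : p.2 - y.2 ≤ sL * (p.1 - y.1) := by
    refine le_of_mul_le_mul_left ?_ h0
    linear_combination hL - sL * hmul
  have hslopeR : sR * (p.1 - y.1) ≤ p.2 - y.2 := by
    refine le_of_mul_le_mul_left ?_ h0
    linear_combination hR + sR * hmul
  have h1t : 0 ≤ 1 - t₀ := sub_nonneg.2 h1
  constructor
  · linear_combination hx + mul_le_mul_of_nonneg_left hslopeL h1t - sL * hmul
  · linear_combination hw + mul_le_mul_of_nonneg_left hslopeR h1t + sR * hmul
end
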